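/- arXiv:1704.08349 — 4 statements merged into one kernel-verified Lean document; each statement's English description precedes it below -/
import Mathlib

section
/- Cone condition for the multivariate Lasso error: Let X be a real n×p matrix, C* a real p×q matrix, E a real n×q matrix, Y = X C* + E, and λ₀ > 0. Suppose the p×q matrix C̃ minimizes C ↦ (2n)⁻¹‖Y − XC‖_F² + λ₀‖C‖₁ over all real p×q matrices, and suppose ‖n⁻¹XᵀE‖_∞ ≤ λ₀/2. Let S = {(i,j) : C*_{ij} ≠ 0} be the support of C* and write Δ̃ = C̃ − C*. Then Σ_{(i,j)∉S} |Δ̃_{ij}| ≤ 3 Σ_{(i,j)∈S} |Δ̃_{ij}|. -/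
open Matrix BigOperators

/-- Frobenius norm of a real matrix. -/
noncomputable def frobNorm {m n : ℕ} (M : Matrix (Fin m) (Fin n) ℝ) : ℝ :=
  Real.sqrt (∑ i, ∑ j, (M i j) ^ 2)

/-- Entrywise ℓ₁-norm of a real matrix. -/
noncomputable def l1Norm {m n : ℕ} (M : Matrix (Fin m) (Fin n) ℝ) : ℝ :=
  ∑ i, ∑ j, |M i j|

/-- Entrywise sup-norm of a real matrix. -/
noncomputable def supNorm {m n : ℕ} (M : Matrix (Fin m) (Fin n) ℝ) : ℝ :=
  ⨆ i, ⨆ j, |M i j|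

/-- Cone condition for the multivariate Lasso error: under the dual-norm noise bound
`‖n⁻¹XᵀE‖_∞ ≤ λ₀/2`, the error `Δ̃ = C̃ − C*` of the ℓ₁-penalized least squares
estimator satisfies `∑_{(i,j)∉S} |Δ̃_{ij}| ≤ 3 ∑_{(i,j)∈S} |Δ̃_{ij}|`, where `S` is the
support of `C*`. -/
theorem multivariate_lasso_cone_condition {n p q : ℕ} (hn : 0 < n)
    (X : Matrix (Fin n) (Fin p) ℝ) (Cstar : Matrix (Fin p) (Fin q) ℝ)
    (E : Matrix (Fin n) (Fin q) ℝ) (Y : Matrix (Fin n) (Fin q) ℝ)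
    (hY : Y = X * Cstar + E)
    (lam0 : ℝ) (hlam : 0 < lam0)
    (Ctil : Matrix (Fin p) (Fin q) ℝ)
    (hmin : ∀ C : Matrix (Fin p) (Fin q) ℝ,
      (2 * n : ℝ)⁻¹ * (frobNorm (Y - X * Ctil)) ^ 2 + lam0 * l1Norm Ctil ≤
        (2 * n : ℝ)⁻¹ * (frobNorm (Y - X * C)) ^ 2 + lam0 * l1Norm C)
    (hnoise : supNorm ((n : ℝ)⁻¹ • (Xᵀ * E)) ≤ lam0 / 2) :
    (∑ ij : Fin p × Fin q, if Cstar ij.1 ij.2 = 0 then |(Ctil - Cstar) ij.1 ij.2| else 0) ≤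
      3 * ∑ ij : Fin p × Fin q, if Cstar ij.1 ij.2 ≠ 0 then |(Ctil - Cstar) ij.1 ij.2| else 0 := by
  have hn' : (0:ℝ) < n := by exact_mod_cast hn
  set D := Ctil - Cstar with hD
  have hCt : Ctil = Cstar + D := by rw [hD]; abel
  have hfrob : ∀ M : Matrix (Fin n) (Fin q) ℝ, frobNorm M ^ 2 = ∑ i, ∑ j, (M i j) ^ 2 := by
    intro M
    unfold frobNorm
    exact Real.sq_sqrt (Finset.sum_nonneg fun i _ => Finset.sum_nonneg fun j _ => sq_nonneg _)
  have h1 : Y - X * Ctil = E - X * D := by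
    rw [hY, hCt, Matrix.mul_add]; abel
  have h2 : Y - X * Cstar = E := by rw [hY]; abel
  have hm := hmin Cstar
  rw [h1, h2, hfrob, hfrob] at hm
  have hinner : ∑ i, ∑ j, E i j * (X * D) i j = ∑ k, ∑ j, (Xᵀ * E) k j * D k j := by
    simp only [Matrix.mul_apply, Matrix.transpose_apply, Finset.mul_sum, Finset.sum_mul]
    rw [Finset.sum_comm, Finset.sum_comm (s := (Finset.univ : Finset (Fin p)))]
    refine Finset.sum_congr rfl fun j _ => ?_
    rw [Finset.sum_comm]
    refine Finset.sum_congr rfl fun k _ => Finset.sum_congr rfl fun i _ => ?_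
    ring
  have hexp : ∑ i, ∑ j, (E i j) ^ 2 - 2 * ∑ i, ∑ j, E i j * (X * D) i j
      ≤ ∑ i, ∑ j, ((E - X * D) i j) ^ 2 := by
    simp only [Finset.mul_sum, ← Finset.sum_sub_distrib]
    refine Finset.sum_le_sum fun i _ => Finset.sum_le_sum fun j _ => ?_
    rw [Matrix.sub_apply]
    nlinarith [sq_nonneg ((X * D) i j)]
  have hent : ∀ k j, |(n : ℝ)⁻¹ * (Xᵀ * E) k j| ≤ lam0 / 2 := by
    intro k j
    refine le_trans ?_ hnoise
    unfold supNorm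
    refine le_trans ?_ (le_ciSup (f := fun i => ⨆ j, |((n : ℝ)⁻¹ • (Xᵀ * E)) i j|)
      (Set.finite_range _).bddAbove k)
    exact le_ciSup (f := fun j => |((n : ℝ)⁻¹ • (Xᵀ * E)) k j|) (Set.finite_range _).bddAbove j
  have hhold : (n : ℝ)⁻¹ * ∑ k, ∑ j, (Xᵀ * E) k j * D k j ≤ lam0 / 2 * l1Norm D := by
    unfold l1Norm
    simp only [Finset.mul_sum]
    refine Finset.sum_le_sum fun k _ => Finset.sum_le_sum fun j _ => ?_
    rw [← mul_assoc]
    refine (le_abs_self _).trans ?_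
    rw [abs_mul]
    exact mul_le_mul_of_nonneg_right (hent k j) (abs_nonneg _)
  have hkey : lam0 * l1Norm Ctil - lam0 * l1Norm Cstar ≤ lam0 / 2 * l1Norm D := by
    refine le_trans ?_ hhold
    rw [← hinner]
    have h3 := mul_le_mul_of_nonneg_left hexp (by positivity : (0:ℝ) ≤ (2 * n : ℝ)⁻¹)
    have h4 : (2 * n : ℝ)⁻¹ * (∑ i, ∑ j, (E i j) ^ 2 - 2 * ∑ i, ∑ j, E i j * (X * D) i j)
        = (2 * n : ℝ)⁻¹ * ∑ i, ∑ j, (E i j) ^ 2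
          - (n : ℝ)⁻¹ * ∑ i, ∑ j, E i j * (X * D) i j := by
      rw [mul_inv]; ring
    linarith
  have hkey2 : l1Norm Ctil - l1Norm Cstar ≤ 1 / 2 * l1Norm D := by
    refine le_of_mul_le_mul_left ?_ hlam
    linarith
  have hl1 : ∀ M : Matrix (Fin p) (Fin q) ℝ, l1Norm M = ∑ ij : Fin p × Fin q, |M ij.1 ij.2| := by
    intro M
    rw [Fintype.sum_prod_type]; rfl
  rw [hl1, hl1, hl1] at hkey2
  have hfin : ∑ ij : Fin p × Fin q, ((if Cstar ij.1 ij.2 = 0 then |D ij.1 ij.2| else 0)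
      - 3 * (if Cstar ij.1 ij.2 ≠ 0 then |D ij.1 ij.2| else 0))
      ≤ ∑ ij : Fin p × Fin q,
        2 * (|Ctil ij.1 ij.2| - |Cstar ij.1 ij.2| - 1 / 2 * |D ij.1 ij.2|) := by
    refine Finset.sum_le_sum fun ij _ => ?_
    have hd : D ij.1 ij.2 = Ctil ij.1 ij.2 - Cstar ij.1 ij.2 := by rw [hD, Matrix.sub_apply]
    by_cases h : Cstar ij.1 ij.2 = 0
    · simp only [h, hd]
      simp
      linarith
    · simp only [h, if_false, ne_eq, not_false_eq_true, if_true]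
      have h5 := abs_sub_abs_le_abs_sub (Cstar ij.1 ij.2) (Ctil ij.1 ij.2)
      rw [abs_sub_comm, ← hd] at h5
      linarith
  rw [← Finset.mul_sum, Finset.sum_sub_distrib, Finset.sum_sub_distrib, Finset.sum_sub_distrib,
    ← Finset.mul_sum, ← Finset.mul_sum] at hfin
  linarith
end

section
/- Deterministic oracle inequality for the multivariate Lasso (Step 1 of Theorem 1): Let X be a real n×p matrix, C* a real p×q matrix with s = ‖C*‖₀ nonzero entries, E a real n×q matrix, Y = X C* + E, λ₀ > 0, and c₂ > 0. Suppose (i) the p×q matrix C̃ minimizes C ↦ (2n)⁻¹‖Y − XC‖_F² + λ₀‖C‖₁ over all real p×q matrices, (ii) ‖n⁻¹XᵀE‖_∞ ≤ λ₀/2, and (iii) n⁻¹‖X(C̃ − C*)‖_F² ≥ c₂‖C̃ − C*‖_F². Then ‖C̃ − C*‖_F ≤ (12/c₂) s^{1/2} λ₀. -/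
open Matrix BigOperators

/-- Number of nonzero entries of a real matrix. -/
noncomputable def l0Norm {m n : ℕ} (M : Matrix (Fin m) (Fin n) ℝ) : ℕ :=
  Nat.card {ij : Fin m × Fin n // M ij.1 ij.2 ≠ 0}

theorem frobNorm_sq_aux {m n : ℕ} (M : Matrix (Fin m) (Fin n) ℝ) :
    frobNorm M ^ 2 = ∑ i, ∑ j, (M i j) ^ 2 := by
  unfold frobNorm
  exact Real.sq_sqrt (Finset.sum_nonneg fun i _ => Finset.sum_nonneg fun j _ => sq_nonneg _)

theorem le_supNorm_aux {m n : ℕ} (M : Matrix (Fin m) (Fin n) ℝ) (i : Fin m) (j : Fin n) :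
    |M i j| ≤ supNorm M := by
  unfold supNorm
  exact (le_ciSup (f := fun j => |M i j|) (Set.finite_range _).bddAbove j).trans
    (le_ciSup (f := fun i => ⨆ j, |M i j|) (Set.finite_range _).bddAbove i)

theorem inner_mul_aux {n p q : ℕ} (X : Matrix (Fin n) (Fin p) ℝ)
    (D : Matrix (Fin p) (Fin q) ℝ) (E : Matrix (Fin n) (Fin q) ℝ) :
    ∑ i, ∑ j, E i j * (X * D) i j = ∑ k, ∑ j, (Xᵀ * E) k j * D k j := by
  have h : (Eᵀ * (X * D)).trace = ((Xᵀ * E)ᵀ * D).trace := by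
    rw [Matrix.transpose_mul, Matrix.transpose_transpose, Matrix.mul_assoc]
  simp only [Matrix.trace, Matrix.diag, Matrix.mul_apply (M := Eᵀ),
    Matrix.mul_apply (M := (Xᵀ * E)ᵀ), Matrix.transpose_apply] at h
  rw [Finset.sum_comm, h, Finset.sum_comm]

theorem frob_expand_aux {n q : ℕ} (E Z : Matrix (Fin n) (Fin q) ℝ) :
    frobNorm (E - Z) ^ 2 = frobNorm E ^ 2 - 2 * (∑ i, ∑ j, E i j * Z i j) + frobNorm Z ^ 2 := by
  simp only [frobNorm_sq_aux, Finset.mul_sum, ← Finset.sum_sub_distrib, ← Finset.sum_add_distrib]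
  refine Finset.sum_congr rfl fun i _ => Finset.sum_congr rfl fun j _ => ?_
  simp only [Matrix.sub_apply]
  ring

open Classical in
theorem support_sum_aux {p q : ℕ} (C D : Matrix (Fin p) (Fin q) ℝ) :
    ∑ k, ∑ j, (if C k j ≠ 0 then |D k j| else 0) ≤ Real.sqrt (l0Norm C) * frobNorm D := by
  have hcs := Finset.sum_mul_sq_le_sq_mul_sq (Finset.univ : Finset (Fin p × Fin q))
    (fun x => if C x.1 x.2 ≠ 0 then (1 : ℝ) else 0) (fun x => |D x.1 x.2|)
  have h1 : ∑ x : Fin p × Fin q, (if C x.1 x.2 ≠ 0 then (1 : ℝ) else 0) ^ 2 = l0Norm C := by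
    unfold l0Norm
    rw [Nat.card_eq_fintype_card, Fintype.card_subtype]
    simp only [ite_pow, one_pow, ne_eq, OfNat.ofNat_ne_zero, not_false_eq_true, zero_pow]
    rw [Finset.sum_boole]
  have h2 : ∑ x : Fin p × Fin q, |D x.1 x.2| ^ 2 = frobNorm D ^ 2 := by
    rw [frobNorm_sq_aux, Fintype.sum_prod_type]
    simp only [sq_abs]
  have h3 : ∑ x : Fin p × Fin q, (if C x.1 x.2 ≠ 0 then (1 : ℝ) else 0) * |D x.1 x.2|
      = ∑ k, ∑ j, (if C k j ≠ 0 then |D k j| else 0) := by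
    rw [Fintype.sum_prod_type]
    simp only [ite_mul, one_mul, zero_mul]
  rw [h1, h2, h3] at hcs
  have hF : 0 ≤ frobNorm D := Real.sqrt_nonneg _
  refine (abs_le_of_sq_le_sq' ?_ (by positivity)).2
  rw [mul_pow, Real.sq_sqrt (Nat.cast_nonneg _)]
  exact hcs

/-- Deterministic oracle inequality for the multivariate Lasso: under the dual-norm noise
bound and the restricted eigenvalue condition, the ℓ₁-penalized least squares estimator
satisfies `‖C̃ − C*‖_F ≤ (12/c₂) √s λ₀` with `s = ‖C*‖₀`. -/
theorem multivariate_lasso_oracle_inequality {n p q : ℕ} (hn : 0 < n)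
    (X : Matrix (Fin n) (Fin p) ℝ) (Cstar : Matrix (Fin p) (Fin q) ℝ)
    (E : Matrix (Fin n) (Fin q) ℝ) (Y : Matrix (Fin n) (Fin q) ℝ)
    (hY : Y = X * Cstar + E)
    (lam0 : ℝ) (hlam : 0 < lam0) (c2 : ℝ) (hc2 : 0 < c2)
    (Ctil : Matrix (Fin p) (Fin q) ℝ)
    (hmin : ∀ C : Matrix (Fin p) (Fin q) ℝ,
      (2 * n : ℝ)⁻¹ * (frobNorm (Y - X * Ctil)) ^ 2 + lam0 * l1Norm Ctil ≤
        (2 * n : ℝ)⁻¹ * (frobNorm (Y - X * C)) ^ 2 + lam0 * l1Norm C)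
    (hnoise : supNorm ((n : ℝ)⁻¹ • (Xᵀ * E)) ≤ lam0 / 2)
    (hRE : c2 * (frobNorm (Ctil - Cstar)) ^ 2 ≤
      (n : ℝ)⁻¹ * (frobNorm (X * (Ctil - Cstar))) ^ 2) :
    frobNorm (Ctil - Cstar) ≤ (12 / c2) * Real.sqrt (l0Norm Cstar) * lam0 := by
  classical
  set D := Ctil - Cstar with hD
  have hF : 0 ≤ frobNorm D := Real.sqrt_nonneg _
  have hn' : (0 : ℝ) < n := by exact_mod_cast hn
  have h := hmin Cstar
  have e1 : Y - X * Ctil = E - X * D := by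
    rw [hY, hD, Matrix.mul_sub]; abel
  have e2 : Y - X * Cstar = E := by rw [hY]; abel
  rw [e1, e2, frob_expand_aux, inner_mul_aux] at h
  have hpt : ∑ k, ∑ j, (((n : ℝ)⁻¹ • (Xᵀ * E)) k j * D k j + lam0 * (|Cstar k j| - |Ctil k j|))
      ≤ ∑ k, ∑ j, (3 / 2 * lam0) * (if Cstar k j ≠ 0 then |D k j| else 0) := by
    refine Finset.sum_le_sum fun k _ => Finset.sum_le_sum fun j _ => ?_
    have a1 := (le_supNorm_aux ((n : ℝ)⁻¹ • (Xᵀ * E)) k j).trans hnoise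
    have a2 : ((n : ℝ)⁻¹ • (Xᵀ * E)) k j * D k j ≤ lam0 / 2 * |D k j| := by
      refine (le_abs_self _).trans ?_
      rw [abs_mul]
      exact mul_le_mul_of_nonneg_right a1 (abs_nonneg _)
    have hDk : D k j = Ctil k j - Cstar k j := rfl
    split_ifs with hc
    · have a3 : |Cstar k j| - |Ctil k j| ≤ |D k j| := by
        rw [hDk, abs_sub_comm]; exact abs_sub_abs_le_abs_sub _ _
      nlinarith
    · have hc0 : Cstar k j = 0 := not_not.mp hc
      have : |D k j| = |Ctil k j| := by rw [hDk, hc0, sub_zero]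
      rw [hc0, abs_zero]
      rw [this] at a2
      nlinarith [abs_nonneg (Ctil k j)]
  have hs := support_sum_aux Cstar D
  simp only [Finset.sum_add_distrib, ← Finset.mul_sum, Finset.sum_sub_distrib,
    Matrix.smul_apply, smul_eq_mul, mul_assoc (n : ℝ)⁻¹] at hpt
  change _ + lam0 * (l1Norm Cstar - l1Norm Ctil) ≤ _ at hpt
  set T := ∑ k, ∑ j, (Xᵀ * E) k j * D k j
  set S := ∑ k, ∑ j, (if Cstar k j ≠ 0 then |D k j| else 0)
  have e3 : (2 * n : ℝ)⁻¹ = (n : ℝ)⁻¹ / 2 := by rw [mul_inv]; ring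
  rw [e3] at h
  have hS : 3 / 2 * lam0 * S ≤ 3 / 2 * lam0 * (Real.sqrt (l0Norm Cstar) * frobNorm D) :=
    mul_le_mul_of_nonneg_left hs (by positivity)
  have key : c2 * frobNorm D ^ 2 ≤ 3 * lam0 * (Real.sqrt (l0Norm Cstar) * frobNorm D) := by
    linarith
  have hr : 0 ≤ Real.sqrt (l0Norm Cstar) := Real.sqrt_nonneg _
  have e4 : 12 / c2 * Real.sqrt (l0Norm Cstar) * lam0
      = (12 * (Real.sqrt (l0Norm Cstar) * lam0)) / c2 := by ring
  rw [e4, le_div_iff₀ hc2]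
  rcases hF.eq_or_lt with h0 | h0
  · rw [← h0, zero_mul]; positivity
  · have : c2 * frobNorm D ≤ 3 * lam0 * Real.sqrt (l0Norm Cstar) := by
      refine le_of_mul_le_mul_right ?_ h0
      linarith
    nlinarith [mul_nonneg hr hlam.le]
end

section
/- Deterministic Frobenius-norm error bounds for the SOFAR estimator (bounds (a) and (b) of Theorem 2, deterministic core): Let X be a real n×p matrix. Let Ĉ, C* be real p×q matrices and set Δ = Ĉ − C*; let D̂, D* (diagonal q×q), Â, A* (p×q), B̂, B* (q×q) be matrices and set Δ_d = D̂ − D*, Δ_a = Â − A*, Δ_b = B̂ − B*. Let η, λ, c₂, τ > 0 and assume: (H1) ‖Δ_a‖_F + ‖Δ_b‖_F + ‖Δ_d‖_F ≤ η‖Δ‖_F; (H2) c₂‖Δ‖_F² ≤ n⁻¹‖XΔ‖_F²; (H3) n⁻¹‖XΔ‖_F² ≤ λ(‖Δ_d‖₁ + ‖Δ_a‖₁ + ‖Δ_b‖₁); (H4) every entry of each of D̂, D*, Â, A*, B̂, B* is either zero or has absolute value at least τ; and (H5) x := λ²η⁴/(c₂²τ²) < 1. Then, with s₀ = ‖D*‖₀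 + ‖A*‖₀ + ‖B*‖₀, one has ‖Δ‖_F ≤ (λη/c₂)(s₀/(1 − x))^{1/2} and ‖Δ_d‖_F + ‖Δ_a‖_F + ‖Δ_b‖_F ≤ (λη²/c₂)(s₀/(1 − x))^{1/2}. -/
open Matrix BigOperators

/-- Every entry of `M` is either zero or at least `τ` in absolute value. -/
def Thresholded {m n : ℕ} (τ : ℝ) (M : Matrix (Fin m) (Fin n) ℝ) : Prop :=
  ∀ i j, M i j = 0 ∨ τ ≤ |M i j|

/-- Cauchy-Schwarz on the support: `‖Δ‖₁² ≤ (s + ‖Δ‖_F²/τ²) ‖Δ‖_F²`. -/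
lemma l1Norm_sq_le {m n : ℕ} {τ : ℝ} (hτ : 0 < τ) (M N : Matrix (Fin m) (Fin n) ℝ)
    (hM : Thresholded τ M) :
    (l1Norm (M - N)) ^ 2 ≤
      ((l0Norm N : ℝ) + (frobNorm (M - N)) ^ 2 / τ ^ 2) * (frobNorm (M - N)) ^ 2 := by
  classical
  have hF : (frobNorm (M - N)) ^ 2 = ∑ x : Fin m × Fin n, ((M - N) x.1 x.2) ^ 2 := by
    rw [frobNorm, Real.sq_sqrt (by positivity), Fintype.sum_prod_type]
  have hl : l1Norm (M - N) = ∑ x : Fin m × Fin n, |(M - N) x.1 x.2| := by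
    rw [l1Norm, Fintype.sum_prod_type]
  have h0 : (l0Norm N : ℝ) = ∑ x : Fin m × Fin n, (if N x.1 x.2 ≠ 0 then (1 : ℝ) else 0) := by
    rw [l0Norm, Nat.card_eq_fintype_card, Fintype.card_subtype, Finset.sum_boole]
  have hw : (l0Norm N : ℝ) + (frobNorm (M - N)) ^ 2 / τ ^ 2 =
      ∑ x : Fin m × Fin n,
        ((if N x.1 x.2 ≠ 0 then (1 : ℝ) else 0) + ((M - N) x.1 x.2) ^ 2 / τ ^ 2) := by
    rw [Finset.sum_add_distrib, h0, hF, Finset.sum_div]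
  rw [hw, hF, hl]
  apply Finset.sum_sq_le_sum_mul_sum_of_sq_le_mul
  · intro x _
    split_ifs <;> positivity
  · intro x _
    positivity
  · intro x _
    rw [sq_abs]
    by_cases hN : N x.1 x.2 = 0
    · rcases hM x.1 x.2 with h | h
      · simp [hN, h]
      · apply le_mul_of_one_le_left (sq_nonneg _)
        have : τ ^ 2 ≤ (M x.1 x.2) ^ 2 := by
          rw [← sq_abs (M x.1 x.2)]
          gcongr
        simp only [hN, ne_eq, not_true_eq_false, if_false, zero_add, Matrix.sub_apply, sub_zero]
        rwa [one_le_div (by positivity)]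
    · apply le_mul_of_one_le_left (sq_nonneg _)
      rw [if_pos hN]
      have : 0 ≤ ((M - N) x.1 x.2) ^ 2 / τ ^ 2 := by positivity
      linarith

lemma cauchy_three {l1 l2 l3 K1 K2 K3 G1 G2 G3 : ℝ} (hK1 : 0 ≤ K1) (hK2 : 0 ≤ K2) (hK3 : 0 ≤ K3)
    (hG1 : 0 ≤ G1) (hG2 : 0 ≤ G2) (hG3 : 0 ≤ G3)
    (h1 : l1 ^ 2 ≤ K1 * G1) (h2 : l2 ^ 2 ≤ K2 * G2) (h3 : l3 ^ 2 ≤ K3 * G3) :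
    (l1 + l2 + l3) ^ 2 ≤ (K1 + K2 + K3) * (G1 + G2 + G3) := by
  have := Finset.sum_sq_le_sum_mul_sum_of_sq_le_mul (Finset.univ : Finset (Fin 3))
    (r := ![l1, l2, l3]) (f := ![K1, K2, K3]) (g := ![G1, G2, G3])
    (by intro i _; fin_cases i <;> simpa) (by intro i _; fin_cases i <;> simpa)
    (by intro i _; fin_cases i <;> simpa)
  simpa [Fin.sum_univ_three] using this

/-- Deterministic Frobenius-norm error bounds for the SOFAR estimator (bounds (a) and (b)
of Theorem 2, deterministic core). -/
theorem sofar_frobenius_error_bounds {n p q : ℕ}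
    (X : Matrix (Fin n) (Fin p) ℝ)
    (Chat Cstar : Matrix (Fin p) (Fin q) ℝ)
    (Dhat Dstar : Matrix (Fin q) (Fin q) ℝ) (hDhatDiag : Dhat.IsDiag)
    (hDstarDiag : Dstar.IsDiag)
    (Ahat Astar : Matrix (Fin p) (Fin q) ℝ)
    (Bhat Bstar : Matrix (Fin q) (Fin q) ℝ)
    (η lam c2 τ : ℝ) (hη : 0 < η) (hlam : 0 < lam) (hc2 : 0 < c2) (hτ : 0 < τ)
    (H1 : frobNorm (Ahat - Astar) + frobNorm (Bhat - Bstar) + frobNorm (Dhat - Dstar) ≤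
      η * frobNorm (Chat - Cstar))
    (H2 : c2 * (frobNorm (Chat - Cstar)) ^ 2 ≤
      (n : ℝ)⁻¹ * (frobNorm (X * (Chat - Cstar))) ^ 2)
    (H3 : (n : ℝ)⁻¹ * (frobNorm (X * (Chat - Cstar))) ^ 2 ≤
      lam * (l1Norm (Dhat - Dstar) + l1Norm (Ahat - Astar) + l1Norm (Bhat - Bstar)))
    (H4D : Thresholded τ Dhat) (H4Ds : Thresholded τ Dstar)
    (H4A : Thresholded τ Ahat) (H4As : Thresholded τ Astar)
    (H4B : Thresholded τ Bhat) (H4Bs : Thresholded τ Bstar)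
    (H5 : lam ^ 2 * η ^ 4 / (c2 ^ 2 * τ ^ 2) < 1) :
    frobNorm (Chat - Cstar) ≤ (lam * η / c2) *
        Real.sqrt (((l0Norm Dstar + l0Norm Astar + l0Norm Bstar : ℕ) : ℝ) /
          (1 - lam ^ 2 * η ^ 4 / (c2 ^ 2 * τ ^ 2))) ∧
      frobNorm (Dhat - Dstar) + frobNorm (Ahat - Astar) + frobNorm (Bhat - Bstar) ≤
        (lam * η ^ 2 / c2) *
          Real.sqrt (((l0Norm Dstar + l0Norm Astar + l0Norm Bstar : ℕ) : ℝ) /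
            (1 - lam ^ 2 * η ^ 4 / (c2 ^ 2 * τ ^ 2))) := by
  have nn : ∀ {a b : ℕ} (M : Matrix (Fin a) (Fin b) ℝ), 0 ≤ frobNorm M :=
    fun M => Real.sqrt_nonneg _
  have ln : ∀ {a b : ℕ} (M : Matrix (Fin a) (Fin b) ℝ), 0 ≤ l1Norm M :=
    fun M => Finset.sum_nonneg fun i _ => Finset.sum_nonneg fun j _ => abs_nonneg _
  have hC := cauchy_three (by positivity) (by positivity) (by positivity) (by positivity)
    (by positivity) (by positivity) (l1Norm_sq_le hτ Dhat Dstar H4D)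
    (l1Norm_sq_le hτ Ahat Astar H4A) (l1Norm_sq_le hτ Bhat Bstar H4B)
  have hF := nn (Chat - Cstar)
  have hd := nn (Dhat - Dstar)
  have ha := nn (Ahat - Astar)
  have hb := nn (Bhat - Bstar)
  have hL : 0 ≤ l1Norm (Dhat - Dstar) + l1Norm (Ahat - Astar) + l1Norm (Bhat - Bstar) :=
    add_nonneg (add_nonneg (ln _) (ln _)) (ln _)
  have h23 := H2.trans H3
  push_cast
  have hs : (0 : ℝ) ≤ (l0Norm Dstar : ℝ) + l0Norm Astar + l0Norm Bstar := by positivity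
  clear H2 H3
  generalize frobNorm (Chat - Cstar) = F at *
  generalize frobNorm (Dhat - Dstar) = d at *
  generalize frobNorm (Ahat - Astar) = a at *
  generalize frobNorm (Bhat - Bstar) = b at *
  generalize l1Norm (Dhat - Dstar) + l1Norm (Ahat - Astar) + l1Norm (Bhat - Bstar) = L at *
  have hG : d ^ 2 + a ^ 2 + b ^ 2 ≤ η ^ 2 * F ^ 2 := by
    have : (a + b + d) ^ 2 ≤ (η * F) ^ 2 := by gcongr
    nlinarith [mul_nonneg ha hb, mul_nonneg ha hd, mul_nonneg hb hd]
  have hK : (l0Norm Dstar : ℝ) + d ^ 2 / τ ^ 2 + (l0Norm Astar + a ^ 2 / τ ^ 2) +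
      (l0Norm Bstar + b ^ 2 / τ ^ 2) ≤
      ((l0Norm Dstar : ℝ) + l0Norm Astar + l0Norm Bstar) + η ^ 2 * F ^ 2 / τ ^ 2 := by
    have : (d ^ 2 + a ^ 2 + b ^ 2) / τ ^ 2 ≤ η ^ 2 * F ^ 2 / τ ^ 2 := by gcongr
    rw [add_div, add_div] at this
    linarith
  generalize (l0Norm Dstar : ℝ) + l0Norm Astar + l0Norm Bstar = s at *
  have hL2 : L ^ 2 ≤ (s + η ^ 2 * F ^ 2 / τ ^ 2) * (η ^ 2 * F ^ 2) :=
    hC.trans (mul_le_mul hK hG (by positivity) (by positivity))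
  have hx : 0 < 1 - lam ^ 2 * η ^ 4 / (c2 ^ 2 * τ ^ 2) := by linarith
  have main : F ≤ (lam * η / c2) * Real.sqrt (s / (1 - lam ^ 2 * η ^ 4 / (c2 ^ 2 * τ ^ 2))) := by
    rcases hF.eq_or_lt with h0 | hpos
    · rw [← h0]; positivity
    have h4 : (c2 * F ^ 2) ^ 2 ≤ lam ^ 2 * ((s + η ^ 2 * F ^ 2 / τ ^ 2) * (η ^ 2 * F ^ 2)) := by
      calc (c2 * F ^ 2) ^ 2 ≤ (lam * L) ^ 2 := by gcongr
        _ = lam ^ 2 * L ^ 2 := by ring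
        _ ≤ _ := by gcongr
    have h5 : c2 ^ 2 * F ^ 2 ≤ lam ^ 2 * η ^ 2 * (s + η ^ 2 * F ^ 2 / τ ^ 2) := by
      have hp : 0 < F ^ 2 := by positivity
      refine le_of_mul_le_mul_right ?_ hp
      linarith
    have h6 : F ^ 2 * (1 - lam ^ 2 * η ^ 4 / (c2 ^ 2 * τ ^ 2)) ≤ (lam * η / c2) ^ 2 * s := by
      have e1 : (c2 ^ 2) * (F ^ 2 * (1 - lam ^ 2 * η ^ 4 / (c2 ^ 2 * τ ^ 2))) =
          c2 ^ 2 * F ^ 2 - lam ^ 2 * η ^ 2 * (η ^ 2 * F ^ 2 / τ ^ 2) := by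
        field_simp
      have e2 : (c2 ^ 2) * ((lam * η / c2) ^ 2 * s) = lam ^ 2 * η ^ 2 * s := by
        field_simp
      have hc : 0 < c2 ^ 2 := by positivity
      refine le_of_mul_le_mul_left ?_ hc
      rw [e1, e2]
      linarith
    refine (pow_le_pow_iff_left₀ hF (by positivity) two_ne_zero).mp ?_
    rw [mul_pow, Real.sq_sqrt (by positivity), ← mul_div_assoc, le_div_iff₀ hx]
    exact h6
  refine ⟨main, ?_⟩
  calc d + a + b ≤ η * F := by linarith
    _ ≤ η * ((lam * η / c2) *
        Real.sqrt (s / (1 - lam ^ 2 * η ^ 4 / (c2 ^ 2 * τ ^ 2)))) := by gcongr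
    _ = _ := by ring
end

section
/- Deterministic sparsity error bound for the SOFAR estimator (bound (c) of Theorem 2, deterministic core): Let X be a real n×p matrix. Let Ĉ, C* be real p×q matrices and set Δ = Ĉ − C*; let D̂, D* (diagonal q×q), Â, A* (p×q), B̂, B* (q×q) be matrices and set Δ_d = D̂ − D*, Δ_a = Â − A*, Δ_b = B̂ − B*. Let η, λ, c₂, τ > 0 and assume: (H1) ‖Δ_a‖_F + ‖Δ_b‖_F + ‖Δ_d‖_F ≤ η‖Δ‖_F; (H2) c₂‖Δ‖_F² ≤ n⁻¹‖XΔ‖_F²; (H3) n⁻¹‖XΔ‖_F² ≤ λ(‖Δ_d‖₁ + ‖Δ_a‖₁ + ‖Δ_b‖₁); (H4) every entry of each of D̂, D*, Â, A*, B̂, B* is either zero or has absolute value at least τ; and (H5) x := λ²η⁴/(c₂²τ²) < 1. Then, with s₀ = ‖D*‖₀ + ‖A*‖₀ + ‖B*‖₀, one has ‖Δ_d‖₀ + ‖Δ_a‖₀ + ‖Δ_b‖₀ ≤ s₀/(1 − x). -/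
open Matrix BigOperators

lemma l0Norm_eq_sum {m n : ℕ} (M : Matrix (Fin m) (Fin n) ℝ) :
    (l0Norm M : ℝ) = ∑ ij : Fin m × Fin n, if M ij.1 ij.2 ≠ 0 then (1 : ℝ) else 0 := by
  classical
  unfold l0Norm
  rw [Nat.card_eq_fintype_card, Fintype.card_subtype, Finset.sum_boole]

lemma frobNorm_nonneg {m n : ℕ} (M : Matrix (Fin m) (Fin n) ℝ) : 0 ≤ frobNorm M :=
  Real.sqrt_nonneg _

lemma frobNorm_sq {m n : ℕ} (M : Matrix (Fin m) (Fin n) ℝ) :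
    frobNorm M ^ 2 = ∑ ij : Fin m × Fin n, (M ij.1 ij.2) ^ 2 := by
  unfold frobNorm
  have h : 0 ≤ ∑ i, ∑ j, (M i j) ^ 2 :=
    Finset.sum_nonneg fun i _ => Finset.sum_nonneg fun j _ => sq_nonneg (M i j)
  rw [Real.sq_sqrt h, Fintype.sum_prod_type]

lemma l1Norm_le {m n : ℕ} (M : Matrix (Fin m) (Fin n) ℝ) (N : ℝ) (hN : (l0Norm M : ℝ) ≤ N) :
    l1Norm M ≤ Real.sqrt N * frobNorm M := by
  have h0 : (0 : ℝ) ≤ l0Norm M := Nat.cast_nonneg _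
  refine abs_le_of_sq_le_sq' ?_ (mul_nonneg (Real.sqrt_nonneg _) (frobNorm_nonneg M)) |>.2
  rw [mul_pow, Real.sq_sqrt (h0.trans hN)]
  refine le_trans ?_ (mul_le_mul_of_nonneg_right hN (sq_nonneg _))
  rw [frobNorm_sq, l0Norm_eq_sum]
  have := Finset.sum_mul_sq_le_sq_mul_sq Finset.univ
    (fun ij : Fin m × Fin n => if M ij.1 ij.2 ≠ 0 then (1 : ℝ) else 0)
    (fun ij => |M ij.1 ij.2|)
  have e : l1Norm M = ∑ ij : Fin m × Fin n,
      (if M ij.1 ij.2 ≠ 0 then (1 : ℝ) else 0) * |M ij.1 ij.2| := by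
    unfold l1Norm
    rw [Fintype.sum_prod_type]
    refine Finset.sum_congr rfl fun i _ => Finset.sum_congr rfl fun j _ => ?_
    by_cases h : M i j = 0 <;> simp [h]
  rw [e]
  simpa [ite_pow] using this

lemma l0Norm_sub_le {m n : ℕ} (τ : ℝ) (hτ : 0 < τ) (H S : Matrix (Fin m) (Fin n) ℝ)
    (hH : Thresholded τ H) :
    (l0Norm (H - S) : ℝ) * τ ^ 2 ≤ l0Norm S * τ ^ 2 + frobNorm (H - S) ^ 2 := by
  rw [l0Norm_eq_sum, l0Norm_eq_sum, frobNorm_sq, Finset.sum_mul, Finset.sum_mul,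
    ← Finset.sum_add_distrib]
  refine Finset.sum_le_sum fun ij _ => ?_
  have hHij := hH ij.1 ij.2
  have hsub : (H - S) ij.1 ij.2 = H ij.1 ij.2 - S ij.1 ij.2 := rfl
  generalize (H - S) ij.1 ij.2 = u at *
  generalize H ij.1 ij.2 = v at *
  generalize S ij.1 ij.2 = w at *
  subst hsub
  have h1 := sq_nonneg (v - w)
  have h2 := sq_nonneg τ
  by_cases hw : w = 0
  · subst hw
    rcases hHij with h | h
    · simp [h]
    · have h3 : τ ^ 2 ≤ v ^ 2 := by
        rw [← sq_abs v]; gcongr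
      rw [sub_zero] at *
      split_ifs <;> simp_all
  · rw [if_pos hw]
    split_ifs <;> linarith

/-- Deterministic sparsity error bound for the SOFAR estimator (bound (c)
of Theorem 2, deterministic core). -/
theorem sofar_sparsity_error_bound {n p q : ℕ}
    (X : Matrix (Fin n) (Fin p) ℝ)
    (Chat Cstar : Matrix (Fin p) (Fin q) ℝ)
    (Dhat Dstar : Matrix (Fin q) (Fin q) ℝ) (hDhatDiag : Dhat.IsDiag)
    (hDstarDiag : Dstar.IsDiag)
    (Ahat Astar : Matrix (Fin p) (Fin q) ℝ)
    (Bhat Bstar : Matrix (Fin q) (Fin q) ℝ)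
    (η lam c2 τ : ℝ) (hη : 0 < η) (hlam : 0 < lam) (hc2 : 0 < c2) (hτ : 0 < τ)
    (H1 : frobNorm (Ahat - Astar) + frobNorm (Bhat - Bstar) + frobNorm (Dhat - Dstar) ≤
      η * frobNorm (Chat - Cstar))
    (H2 : c2 * (frobNorm (Chat - Cstar)) ^ 2 ≤
      (n : ℝ)⁻¹ * (frobNorm (X * (Chat - Cstar))) ^ 2)
    (H3 : (n : ℝ)⁻¹ * (frobNorm (X * (Chat - Cstar))) ^ 2 ≤
      lam * (l1Norm (Dhat - Dstar) + l1Norm (Ahat - Astar) + l1Norm (Bhat - Bstar)))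
    (H4D : Thresholded τ Dhat) (H4Ds : Thresholded τ Dstar)
    (H4A : Thresholded τ Ahat) (H4As : Thresholded τ Astar)
    (H4B : Thresholded τ Bhat) (H4Bs : Thresholded τ Bstar)
    (H5 : lam ^ 2 * η ^ 4 / (c2 ^ 2 * τ ^ 2) < 1) :
    ((l0Norm (Dhat - Dstar) + l0Norm (Ahat - Astar) + l0Norm (Bhat - Bstar) : ℕ) : ℝ) ≤
      ((l0Norm Dstar + l0Norm Astar + l0Norm Bstar : ℕ) : ℝ) /
        (1 - lam ^ 2 * η ^ 4 / (c2 ^ 2 * τ ^ 2)) := by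
  have hA := l0Norm_sub_le τ hτ Ahat Astar H4A
  have hB := l0Norm_sub_le τ hτ Bhat Bstar H4B
  have hD := l0Norm_sub_le τ hτ Dhat Dstar H4D
  push_cast
  have nD : (0 : ℝ) ≤ l0Norm (Dhat - Dstar) := Nat.cast_nonneg _
  have nA : (0 : ℝ) ≤ l0Norm (Ahat - Astar) := Nat.cast_nonneg _
  have nB : (0 : ℝ) ≤ l0Norm (Bhat - Bstar) := Nat.cast_nonneg _
  obtain ⟨N, hN⟩ : ∃ N : ℝ, N = (l0Norm (Dhat - Dstar) : ℝ) + l0Norm (Ahat - Astar)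
    + l0Norm (Bhat - Bstar) := ⟨_, rfl⟩
  have lA := l1Norm_le (Ahat - Astar) N (by linarith)
  have lB := l1Norm_le (Bhat - Bstar) N (by linarith)
  have lD := l1Norm_le (Dhat - Dstar) N (by linarith)
  have fA := frobNorm_nonneg (Ahat - Astar)
  have fB := frobNorm_nonneg (Bhat - Bstar)
  have fD := frobNorm_nonneg (Dhat - Dstar)
  have fC := frobNorm_nonneg (Chat - Cstar)
  have H23 := H2.trans H3
  rw [← hN]
  generalize frobNorm (Ahat - Astar) = a at *
  generalize frobNorm (Bhat - Bstar) = b at *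
  generalize frobNorm (Dhat - Dstar) = d at *
  generalize frobNorm (Chat - Cstar) = f at *
  have hN0 : 0 ≤ N := by linarith
  have hr0 := Real.sqrt_nonneg N
  have hr := Real.sq_sqrt hN0
  generalize Real.sqrt N = r at *
  -- bound on the Frobenius error
  have h1 : c2 * f ^ 2 ≤ lam * (r * (η * f)) := by
    refine H23.trans (mul_le_mul_of_nonneg_left ?_ hlam.le)
    have := mul_le_mul_of_nonneg_left H1 hr0
    linarith
  have h2 : c2 * f ≤ lam * r * η := by
    rcases fC.eq_or_lt with h | h
    · rw [← h, mul_zero]; positivity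
    · refine le_of_mul_le_mul_right ?_ h
      linarith
  have h3 : c2 ^ 2 * f ^ 2 ≤ lam ^ 2 * N * η ^ 2 := by
    have := pow_le_pow_left₀ (by positivity) h2 2
    rw [← hr]; linarith
  have h4 : a ^ 2 + b ^ 2 + d ^ 2 ≤ η ^ 2 * f ^ 2 := by
    have := pow_le_pow_left₀ (by positivity) H1 2
    nlinarith [mul_nonneg fA fB, mul_nonneg fA fD, mul_nonneg fB fD]
  have h5 : c2 ^ 2 * (a ^ 2 + b ^ 2 + d ^ 2) ≤ lam ^ 2 * η ^ 4 * N := by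
    have e1 := mul_le_mul_of_nonneg_left h4 (sq_nonneg c2)
    have e2 := mul_le_mul_of_nonneg_left h3 (sq_nonneg η)
    linarith
  rw [le_div_iff₀ (by linarith)]
  have hpos : 0 < c2 ^ 2 * τ ^ 2 := by positivity
  have h6 : N * τ ^ 2 ≤ ((l0Norm Dstar : ℝ) + l0Norm Astar + l0Norm Bstar) * τ ^ 2
      + (a ^ 2 + b ^ 2 + d ^ 2) := by
    rw [hN]; linarith
  have h7 := mul_le_mul_of_nonneg_left h6 (sq_nonneg c2)
  refine le_of_mul_le_mul_right ?_ hpos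
  have e : N * (1 - lam ^ 2 * η ^ 4 / (c2 ^ 2 * τ ^ 2)) * (c2 ^ 2 * τ ^ 2)
      = N * (c2 ^ 2 * τ ^ 2) - lam ^ 2 * η ^ 4 * N := by
    field_simp
  rw [e]
  linarith
end
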